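/- There exists a constant c' > 0 such that for all finite simple graphs G₁ and G₂ with χ(G₁) ≥ χ(G₂) ≥ c' · (log χ(G₁))^{1.5}, the Cartesian product G₁ □ G₂ satisfies Hadwiger's conjecture, i.e. η(G₁ □ G₂) ≥ χ(G₁ □ G₂). -/

import Mathlib

open SimpleGraph

/-- `H` is a minor of `G`: there is a family of branch sets in `G`, one for each vertex of `H`,
which are pairwise disjoint, each inducing a connected subgraph of `G`, such that every edge of
`H` is witnessed by an edge of `G` between the corresponding branch sets. -/
def SimpleGraph.IsMinorOf {W V : Type*} (H : SimpleGraph W) (G : SimpleGraph V) : Prop :=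
  ∃ f : W → Set V,
    (∀ w, (G.induce (f w)).Connected) ∧
    (Pairwise fun w w' => Disjoint (f w) (f w')) ∧
    ∀ ⦃w w'⦄, H.Adj w w' → ∃ u ∈ f w, ∃ v ∈ f w', G.Adj u v

/-- The Hadwiger number of `G`: the largest `n` such that `K_n` is a minor of `G`. -/
noncomputable def SimpleGraph.hadwigerNumber {V : Type*} (G : SimpleGraph V) : ℕ :=
  sSup {n : ℕ | (⊤ : SimpleGraph (Fin n)).IsMinorOf G}

namespace SimpleGraph

section Minor

variable {U V W : Type*}

theorem IsMinorOf.trans {H : SimpleGraph W} {G : SimpleGraph V} {K : SimpleGraph U}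
    (h₁ : H.IsMinorOf G) (h₂ : G.IsMinorOf K) : H.IsMinorOf K := by
  obtain ⟨f, fc, fd, fa⟩ := h₁
  obtain ⟨g, gc, gd, ga⟩ := h₂
  have key : ∀ w (v : V) (hv : v ∈ f w) (a b : U) (ha : a ∈ g v) (hb : b ∈ g v),
      (K.induce (⋃ v ∈ f w, g v)).Reachable ⟨a, Set.mem_biUnion hv ha⟩
        ⟨b, Set.mem_biUnion hv hb⟩ := by
    intro w v hv a b ha hb
    exact ((gc v).preconnected ⟨a, ha⟩ ⟨b, hb⟩).map
      (K.induceHomOfLE (Set.subset_biUnion_of_mem hv)).toHom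
  refine ⟨fun w => ⋃ v ∈ f w, g v, fun w => ?_, fun w w' hw => ?_, fun w w' hw => ?_⟩
  · rw [connected_iff_exists_forall_reachable]
    obtain ⟨⟨v₀, hv₀⟩⟩ := (fc w).nonempty
    obtain ⟨⟨u₀, hu₀⟩⟩ := (gc v₀).nonempty
    refine ⟨⟨u₀, Set.mem_biUnion hv₀ hu₀⟩, ?_⟩
    have reach : ∀ v : f w, ∀ (u : U) (hu : u ∈ g v),
        (K.induce (⋃ v ∈ f w, g v)).Reachable ⟨u₀, Set.mem_biUnion hv₀ hu₀⟩
          ⟨u, Set.mem_biUnion v.2 hu⟩ := by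
      intro v
      have hr := (fc w).preconnected ⟨v₀, hv₀⟩ v
      rw [reachable_iff_reflTransGen] at hr
      induction hr with
      | refl => exact fun u hu => key w v₀ hv₀ u₀ u hu₀ hu
      | @tail b c _ hbc ih =>
        intro u hu
        obtain ⟨p, hp, q, hq, hpq⟩ := ga (show G.Adj b c from hbc)
        have hadj : (K.induce (⋃ v ∈ f w, g v)).Adj ⟨p, Set.mem_biUnion b.2 hp⟩
            ⟨q, Set.mem_biUnion c.2 hq⟩ := hpq
        exact ((ih p hp).trans hadj.reachable).trans (key w c c.2 q u hq hu)
    rintro ⟨u, hu⟩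
    obtain ⟨v, hv, huv⟩ := Set.mem_iUnion₂.1 hu
    exact reach ⟨v, hv⟩ u huv
  · simp only [Set.disjoint_iUnion_left, Set.disjoint_iUnion_right]
    intro v hv v' hv'
    refine gd ?_
    rintro rfl
    exact Set.disjoint_left.1 (fd hw) hv' hv
  · obtain ⟨v, hv, v', hv', h⟩ := fa hw
    obtain ⟨u, hu, u', hu', h'⟩ := ga h
    exact ⟨u, Set.mem_biUnion hv hu, u', Set.mem_biUnion hv' hu', h'⟩

theorem induce_singleton_connected (G : SimpleGraph V) (v : V) :
    (G.induce {v}).Connected := by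
  have : Subsingleton ({v} : Set V) := by
    rw [Set.subsingleton_coe]; exact Set.subsingleton_singleton
  exact ⟨fun a b => by rw [Subsingleton.elim a b]⟩

theorem IsMinorOf.of_injective_hom {H : SimpleGraph W} {G : SimpleGraph V} (φ : H →g G)
    (hφ : Function.Injective φ) : H.IsMinorOf G :=
  ⟨fun w => {φ w}, fun w => G.induce_singleton_connected (φ w),
    fun _ _ h => Set.disjoint_singleton.2 (hφ.ne h),
    fun _ _ h => ⟨_, rfl, _, rfl, φ.map_adj h⟩⟩

theorem IsMinorOf.of_le {G G' : SimpleGraph V} (h : G ≤ G') : G.IsMinorOf G' :=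
  .of_injective_hom (.ofLE h) Function.injective_id

theorem isMinorOf_induce (G : SimpleGraph V) (s : Set V) : (G.induce s).IsMinorOf G :=
  .of_injective_hom (Embedding.induce s).toHom Subtype.val_injective

theorem top_isMinorOf_top_of_embedding (e : W ↪ V) :
    (⊤ : SimpleGraph W).IsMinorOf (⊤ : SimpleGraph V) :=
  .of_injective_hom ⟨e, fun h => e.injective.ne h⟩ e.injective

/-- The image of `G` under a map of vertices, with loops removed. -/
def contractionBy (G : SimpleGraph V) (r : V → W) : SimpleGraph W where
  Adj a b := a ≠ b ∧ ∃ u v, r u = a ∧ r v = b ∧ G.Adj u v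
  symm := ⟨fun _ _ ⟨h, u, v, hu, hv, huv⟩ => ⟨h.symm, v, u, hv, hu, huv.symm⟩⟩
  loopless := ⟨fun _ h => h.1 rfl⟩

theorem contractionBy_isMinorOf (G : SimpleGraph V) (r : V → W)
    (hr : ∀ w, (G.induce (r ⁻¹' {w})).Connected) : (G.contractionBy r).IsMinorOf G := by
  refine ⟨fun w => r ⁻¹' {w}, hr, fun w w' h => ?_, ?_⟩
  · exact Disjoint.preimage _ (Set.disjoint_singleton.2 h)
  · rintro w w' ⟨-, u, v, hu, hv, huv⟩
    exact ⟨u, hu, v, hv, huv⟩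

theorem card_le_of_top_isMinorOf [Fintype V] [Fintype W] {G : SimpleGraph V}
    (h : (⊤ : SimpleGraph W).IsMinorOf G) : Fintype.card W ≤ Fintype.card V := by
  obtain ⟨f, fc, fd, -⟩ := h
  choose g hg using fun w => Set.nonempty_coe_sort.1 (fc w).nonempty
  refine Fintype.card_le_of_injective g fun a b hab => ?_
  by_contra hne
  exact Set.disjoint_left.1 (fd hne) (hg a) (hab ▸ hg b)

theorem card_le_hadwigerNumber [Fintype V] [Fintype W] {G : SimpleGraph V}
    (h : (⊤ : SimpleGraph W).IsMinorOf G) : Fintype.card W ≤ G.hadwigerNumber := by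
  refine le_csSup ⟨Fintype.card V, fun n hn => ?_⟩
    ((top_isMinorOf_top_of_embedding (Fintype.equivFin W).symm.toEmbedding).trans h)
  simpa using card_le_of_top_isMinorOf hn

end Minor

section Product

variable {V₁ V₂ W₁ W₂ : Type*}

theorem IsMinorOf.boxProd {H₁ : SimpleGraph W₁} {H₂ : SimpleGraph W₂} {G₁ : SimpleGraph V₁}
    {G₂ : SimpleGraph V₂} (h₁ : H₁.IsMinorOf G₁) (h₂ : H₂.IsMinorOf G₂) :
    (H₁ □ H₂).IsMinorOf (G₁ □ G₂) := by
  obtain ⟨f, fc, fd, fa⟩ := h₁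
  obtain ⟨g, gc, gd, ga⟩ := h₂
  refine ⟨fun w => f w.1 ×ˢ g w.2, fun w => ?_, fun w w' h => ?_, fun w w' h => ?_⟩
  · refine ((fc w.1).boxProd (gc w.2)).map
      (⟨fun x => ⟨(x.1.1, x.2.1), x.1.2, x.2.2⟩, ?_⟩ :
        (G₁.induce (f w.1) □ G₂.induce (g w.2)) →g _) ?_
    · rintro ⟨a, b⟩ ⟨c, d⟩ h
      rw [boxProd_adj] at h
      simpa [boxProd_adj, Subtype.ext_iff] using h
    · rintro ⟨⟨a, b⟩, ha, hb⟩
      exact ⟨(⟨a, ha⟩, ⟨b, hb⟩), rfl⟩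
  · refine Set.disjoint_prod.2 ?_
    by_cases h1 : w.1 = w'.1
    · exact Or.inr (gd fun h2 => h (Prod.ext h1 h2))
    · exact Or.inl (fd h1)
  · rcases w with ⟨a, b⟩
    rcases w' with ⟨c, d⟩
    rw [boxProd_adj] at h
    rcases h with ⟨h, rfl : b = d⟩ | ⟨h, rfl : a = c⟩
    · obtain ⟨u, hu, v, hv, huv⟩ := fa h
      obtain ⟨⟨z, hz⟩⟩ := (gc b).nonempty
      exact ⟨(u, z), ⟨hu, hz⟩, (v, z), ⟨hv, hz⟩, by simp [boxProd_adj, huv]⟩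
    · obtain ⟨u, hu, v, hv, huv⟩ := ga h
      obtain ⟨⟨z, hz⟩⟩ := (fc a).nonempty
      exact ⟨(z, u), ⟨hz, hu⟩, (z, v), ⟨hz, hv⟩, by simp [boxProd_adj, huv]⟩

/-- Branch sets: a row of a square grid in one copy joined to the matching column in another. -/
theorem top_isMinorOf_boxProd_top (P S : Type*) :
    (⊤ : SimpleGraph (P × S)).IsMinorOf
      ((⊤ : SimpleGraph (P × Bool)) □ (⊤ : SimpleGraph (S × S))) := by
  set K := (⊤ : SimpleGraph (P × Bool)) □ (⊤ : SimpleGraph (S × S)) with hK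
  let B : P × S → Set ((P × Bool) × (S × S)) := fun w =>
    {z | z.1.1 = w.1 ∧ ((z.1.2 = false ∧ z.2.1 = w.2) ∨ (z.1.2 = true ∧ z.2.2 = w.2))}
  have hadj : ∀ a b, a ≠ b → (a.1 = b.1 ∨ a.2 = b.2) → K.Adj a b := by
    rintro ⟨a, b⟩ ⟨c, d⟩ h h'
    simp only [hK, boxProd_adj, top_adj]
    simp only [ne_eq, Prod.mk.injEq] at h h'
    tauto
  refine ⟨B, ?_, ?_, ?_⟩
  · rintro ⟨p, i⟩
    have step : ∀ a b : B (p, i), (a.1.1 = b.1.1 ∨ a.1.2 = b.1.2) →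
        (K.induce (B (p, i))).Reachable a b := by
      intro a b h
      by_cases hab : a = b
      · rw [hab]
      · exact Adj.reachable (show K.Adj a b from
          hadj _ _ (fun h => hab (Subtype.ext h)) h)
    rw [connected_iff_exists_forall_reachable]
    refine ⟨⟨((p, false), (i, i)), by simp [B]⟩, ?_⟩
    rintro ⟨⟨⟨q, b⟩, s⟩, hq : q = p, hb⟩
    subst hq
    cases b
    · exact step _ _ (Or.inl rfl)
    · exact (step ⟨((q, false), (i, i)), by simp [B]⟩ ⟨((q, true), (i, i)), by simp [B]⟩
        (Or.inr rfl)).trans (step _ _ (Or.inl rfl))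
  · rintro ⟨p, i⟩ ⟨q, j⟩ h
    rw [Set.disjoint_left]
    rintro ⟨⟨a, b⟩, s, t⟩ ⟨h1, h2⟩ ⟨h3, h4⟩
    apply h
    cases b <;> simp_all
  · rintro ⟨p, i⟩ ⟨q, j⟩ h
    exact ⟨((p, false), (i, j)), by simp [B], ((q, true), (i, j)), by simp [B],
      hadj _ _ (by simp) (Or.inr rfl)⟩

theorem Colorable.boxProd {G₁ : SimpleGraph V₁} {G₂ : SimpleGraph V₂} {n : ℕ}
    (h₁ : G₁.Colorable n) (h₂ : G₂.Colorable n) : (G₁ □ G₂).Colorable n := by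
  rcases Nat.eq_zero_or_pos n with rfl | hn
  · exact ⟨Coloring.mk (fun v => h₁.some v.1) fun {v} => (h₁.some v.1).elim0⟩
  · have : NeZero n := ⟨hn.ne'⟩
    obtain ⟨c₁⟩ := h₁
    obtain ⟨c₂⟩ := h₂
    refine ⟨Coloring.mk (fun v => c₁ v.1 + c₂ v.2) ?_⟩
    rintro ⟨a, b⟩ ⟨c, d⟩ h
    rw [boxProd_adj] at h
    rcases h with ⟨h, rfl : b = d⟩ | ⟨h, rfl : a = c⟩
    · simpa using c₁.valid h
    · simpa using c₂.valid h

end Product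

section Density

open scoped Classical Finset

universe u

variable {V : Type u}

/-- The common neighbours of two vertices, as a finset. -/
noncomputable def commonNbrs [Fintype V] (G : SimpleGraph V) (x y : V) : Finset V :=
  {v | G.Adj x v ∧ G.Adj y v}

theorem card_adj_pairs [Fintype V] (G : SimpleGraph V) :
    #{p : V × V | G.Adj p.1 p.2} = 2 * #G.edgeFinset := by
  rw [← sum_degrees_eq_twice_card_edges, Finset.card_filter, Fintype.sum_prod_type]
  refine Finset.sum_congr rfl fun v _ => ?_
  rw [← Finset.card_filter, ← card_neighborFinset_eq_degree, neighborFinset_eq_filter]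

theorem exists_le_card_edgeFinset_eq [Fintype V] (G : SimpleGraph V) {m : ℕ}
    (hm : m ≤ #G.edgeFinset) : ∃ H ≤ G, #H.edgeFinset = m := by
  obtain ⟨s, hs, rfl⟩ := Finset.exists_subset_card_eq hm
  have hsG : (s : Set (Sym2 V)) ⊆ G.edgeSet := fun e he => mem_edgeFinset.1 (hs he)
  obtain ⟨H, hH⟩ : ∃ H : SimpleGraph V, H.edgeSet = s := by
    refine ⟨fromEdgeSet s, ?_⟩
    rw [edgeSet_fromEdgeSet]
    exact sdiff_eq_left.2 (Set.disjoint_left.2 fun e he h =>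
      G.not_isDiag_of_mem_edgeSet (hsG he) h)
  refine ⟨H, edgeSet_subset_edgeSet.1 (hH ▸ hsG), congrArg _ ?_⟩
  ext e
  rw [mem_edgeFinset, hH, Finset.mem_coe]

/-- Contracting an edge loses that edge and one edge for each triangle on it. -/
theorem exists_minor_of_contract_edge [Fintype V] {G : SimpleGraph V} {x y : V}
    (hxy : G.Adj x y) : ∃ (W : Type u) (_ : Fintype W) (H : SimpleGraph W), H.IsMinorOf G ∧
      Fintype.card W + 1 = Fintype.card V ∧
      #G.edgeFinset ≤ #H.edgeFinset + (1 + #(G.commonNbrs x y)) := by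
  let r : V → {v // v ≠ y} := fun v => if h : v = y then ⟨x, hxy.ne⟩ else ⟨v, h⟩
  have hr : ∀ v, (r v).1 = if v = y then x else v := by
    intro v; by_cases h : v = y <;> simp [r, h]
  refine ⟨{v // v ≠ y}, inferInstance, G.contractionBy r,
    contractionBy_isMinorOf _ _ ?_, ?_, ?_⟩
  · intro w
    by_cases hw : w.1 = x
    · have : r ⁻¹' {w} = {x, y} := by
        ext v
        have := hxy.ne
        simp only [Set.mem_preimage, Set.mem_singleton_iff, Subtype.ext_iff, hr,
          Set.mem_insert_iff]
        grind
      rw [this]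
      exact induce_pair_connected_of_adj hxy
    · have : r ⁻¹' {w} = {w.1} := by
        ext v
        have := w.2
        simp only [Set.mem_preimage, Set.mem_singleton_iff, Subtype.ext_iff, hr]
        grind
      rw [this]
      exact G.induce_singleton_connected _
  · rw [Fintype.card_subtype_compl, Fintype.card_subtype_eq]
    have : 0 < Fintype.card V := Fintype.card_pos_iff.2 ⟨x⟩
    omega
  · set H := G.contractionBy r
    set C := G.commonNbrs x y with hC
    have hCm : ∀ v, v ∈ C ↔ G.Adj x v ∧ G.Adj y v := fun v => by simp [hC, commonNbrs]
    suffices h : #{p : V × V | G.Adj p.1 p.2} ≤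
        #{p : {v // v ≠ y} × {v // v ≠ y} | H.Adj p.1 p.2} +
          (#({y} ×ˢ insert x C) + #(insert x C ×ˢ {y})) by
      rw [card_adj_pairs, card_adj_pairs, Finset.card_product, Finset.card_product,
        Finset.card_singleton] at h
      have := Finset.card_insert_le x C
      omega
    set T : Finset (V × V) := {y} ×ˢ insert x C ∪ insert x C ×ˢ {y} with hT
    refine le_trans ?_ (Nat.add_le_add_left (Finset.card_union_le _ _) _)
    rw [← Nat.sub_le_iff_le_add]
    refine (Finset.le_card_sdiff T _).trans ?_
    have hTm : ∀ p : V × V, p ∈ T ↔ (p.1 = y ∧ (p.2 = x ∨ G.Adj x p.2 ∧ G.Adj y p.2)) ∨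
        ((p.1 = x ∨ G.Adj x p.1 ∧ G.Adj y p.1) ∧ p.2 = y) := fun p => by
      simp only [hT, Finset.mem_union, Finset.mem_product, Finset.mem_singleton,
        Finset.mem_insert, hCm]
    have hxy' := hxy.symm
    have hne := hxy.ne
    have hsymm : ∀ a b, G.Adj a b → G.Adj b a := fun _ _ h => h.symm
    have hirr : ∀ a, ¬ G.Adj a a := fun a => G.irrefl
    refine Finset.card_le_card_of_injOn (fun p => (r p.1, r p.2)) ?_ ?_
    · rintro ⟨a, b⟩ hp
      simp only [Finset.coe_sdiff, Finset.coe_filter, Finset.mem_univ, true_and, Set.mem_sdiff,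
        Set.mem_ofPred_eq, Finset.mem_coe, hTm] at hp
      simp only [Finset.coe_filter, Finset.mem_univ, true_and, Set.mem_ofPred_eq]
      refine ⟨?_, a, b, rfl, rfl, hp.1⟩
      rw [ne_eq, Subtype.ext_iff, hr, hr]
      grind
    · rintro ⟨a, b⟩ hp ⟨c, d⟩ hq heq
      simp only [Finset.coe_sdiff, Finset.coe_filter, Finset.mem_univ, true_and, Set.mem_sdiff,
        Set.mem_ofPred_eq, Finset.mem_coe, hTm] at hp hq
      simp only [Prod.mk.injEq, Subtype.ext_iff, hr] at heq
      simp only [Prod.mk.injEq]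
      grind

theorem exists_minor_of_delete_isolated [Fintype V] {G : SimpleGraph V} {y : V}
    (hy : ∀ x, ¬ G.Adj y x) : ∃ (W : Type u) (_ : Fintype W) (H : SimpleGraph W),
      H.IsMinorOf G ∧ Fintype.card W + 1 = Fintype.card V ∧
      #G.edgeFinset ≤ #H.edgeFinset := by
  obtain ⟨H, hHG, hH⟩ : ∃ H : SimpleGraph {v // v ≠ y}, H.IsMinorOf G ∧
      ∀ a b, H.Adj a b ↔ G.Adj a b :=
    ⟨_, G.isMinorOf_induce {v | v ≠ y}, fun _ _ => Iff.rfl⟩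
  refine ⟨{v // v ≠ y}, inferInstance, H, hHG, ?_, ?_⟩
  · rw [Fintype.card_subtype_compl, Fintype.card_subtype_eq]
    have : 0 < Fintype.card V := Fintype.card_pos_iff.2 ⟨y⟩
    omega
  · suffices h : #{p : V × V | G.Adj p.1 p.2} ≤
        #{p : {v // v ≠ y} × {v // v ≠ y} | H.Adj p.1 p.2} by
      rw [card_adj_pairs, card_adj_pairs] at h
      omega
    refine Finset.card_le_card_of_surjOn (fun p => (p.1.1, p.2.1)) ?_
    rintro ⟨a, b⟩ hp
    simp only [Finset.coe_filter, Finset.mem_univ, true_and, Set.mem_ofPred_eq] at hp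
    have ha : a ≠ y := by rintro rfl; exact hy _ hp
    have hb : b ≠ y := by rintro rfl; exact hy _ hp.symm
    exact ⟨(⟨a, ha⟩, ⟨b, hb⟩), by simpa [hH] using hp, rfl⟩

/-- A minor that keeps many edges and cannot be reduced further without losing too many. -/
theorem exists_minor_irreducible (a : ℕ) {Ψ : ℕ → ℕ} (hΨ : Monotone Ψ) (hΨ₁ : 0 < Ψ 1)
    (n : ℕ) : ∀ (V : Type u) [Fintype V] [Nonempty V] (G : SimpleGraph V),
      Fintype.card V = n → Ψ n ≤ a * #G.edgeFinset →
      ∃ (W : Type u) (_ : Fintype W) (_ : Nonempty W) (H : SimpleGraph W), H.IsMinorOf G ∧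
        Ψ (Fintype.card W) ≤ a * #H.edgeFinset ∧
        a * #H.edgeFinset < Ψ (Fintype.card W) + a ∧ (∀ y, ∃ x, H.Adj y x) ∧
        ∀ x y, H.Adj x y →
          a * #H.edgeFinset < Ψ (Fintype.card W - 1) + a * (1 + #(H.commonNbrs x y)) := by
  induction n with
  | zero =>
    intro V _ _ G hn
    exact absurd hn Fintype.card_ne_zero
  | succ n ih =>
    intro V _ _ G hn hG
    have ha : 0 < a := by
      rcases Nat.eq_zero_or_pos a with rfl | h
      · have := hΨ (show 1 ≤ n + 1 by omega)
        omega
      · exact h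
    have hex : ∃ m, Ψ (n + 1) ≤ a * m := ⟨_, hG⟩
    obtain ⟨H, hHG, hH⟩ := G.exists_le_card_edgeFinset_eq (Nat.find_min' hex hG)
    have hlow : Ψ (n + 1) ≤ a * #H.edgeFinset := hH ▸ Nat.find_spec hex
    have hup : a * #H.edgeFinset < Ψ (n + 1) + a := by
      rw [hH]
      rcases Nat.eq_zero_or_pos (Nat.find hex) with h0 | h0
      · rw [h0]; omega
      · have := Nat.find_min hex (Nat.sub_lt h0 one_pos)
        rw [Nat.mul_sub, mul_one] at this
        omega
    have hmono : Ψ n ≤ Ψ (n + 1) := hΨ (Nat.le_succ n)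
    have descend : ∀ (W : Type u) (_ : Fintype W) (K : SimpleGraph W), K.IsMinorOf H →
        Fintype.card W + 1 = Fintype.card V → Ψ n ≤ a * #K.edgeFinset →
        ∃ (W : Type u) (_ : Fintype W) (_ : Nonempty W) (H : SimpleGraph W), H.IsMinorOf G ∧
          Ψ (Fintype.card W) ≤ a * #H.edgeFinset ∧
          a * #H.edgeFinset < Ψ (Fintype.card W) + a ∧ (∀ y, ∃ x, H.Adj y x) ∧
          ∀ x y, H.Adj x y →
            a * #H.edgeFinset < Ψ (Fintype.card W - 1) + a * (1 + #(H.commonNbrs x y)) := by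
      intro W _ K hKH hW hK
      rcases Nat.eq_zero_or_pos n with rfl | hpos
      · have h1 : #H.edgeFinset ≤ (Fintype.card V).choose 2 := card_edgeFinset_le_card_choose_two
        have h2 : #H.edgeFinset = 0 := by rw [hn] at h1; simpa using h1
        rw [h2] at hlow
        simp only [zero_add] at hlow
        omega
      · have : Nonempty W := Fintype.card_pos_iff.1 (by omega)
        obtain ⟨U, iU, nU, L, hL, rest⟩ := ih W K (by omega) hK
        exact ⟨U, iU, nU, L, (hL.trans hKH).trans (.of_le hHG), rest⟩
    by_cases hiso : ∃ y, ∀ x, ¬ H.Adj y x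
    · obtain ⟨y, hy⟩ := hiso
      obtain ⟨W, _, K, hK, hW, hKe⟩ := exists_minor_of_delete_isolated hy
      exact descend W _ K hK hW ((hmono.trans hlow).trans (Nat.mul_le_mul_left a hKe))
    push Not at hiso
    by_cases htri : ∃ x y, H.Adj x y ∧ Ψ n + a * (1 + #(H.commonNbrs x y)) ≤ a * #H.edgeFinset
    · obtain ⟨x, y, hxy, h⟩ := htri
      obtain ⟨W, _, K, hK, hW, hKe⟩ := exists_minor_of_contract_edge hxy
      refine descend W _ K hK hW ?_
      have := Nat.mul_le_mul_left a hKe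
      rw [Nat.mul_add] at this
      omega
    push Not at htri
    refine ⟨V, inferInstance, inferInstance, H, .of_le hHG, ?_, ?_, hiso, ?_⟩
    · rwa [hn]
    · rwa [hn]
    · rwa [hn]

/-- The neighbourhood of a vertex of small degree in an irreducible minor. -/
theorem exists_minor_neighborhood [Fintype V] [Nonempty V] (G : SimpleGraph V) (a : ℕ)
    {Ψ : ℕ → ℕ} (hΨ : Monotone Ψ) (hΨ₁ : 0 < Ψ 1)
    (hG : Ψ (Fintype.card V) ≤ a * #G.edgeFinset) :
    ∃ (n e : ℕ) (W : Type u) (_ : Fintype W) (_ : Nonempty W) (H : SimpleGraph W),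
      H.IsMinorOf G ∧ 0 < n ∧ Ψ n ≤ a * e ∧ a * e < Ψ n + a ∧ 2 * e ≤ n * (n - 1) ∧
      n * Fintype.card W ≤ 2 * e ∧
      ∀ w, a * e < Ψ (n - 1) + a * (1 + H.degree w) := by
  obtain ⟨U, _, _, K, hKG, hlow, hup, hiso, htri⟩ :=
    exists_minor_irreducible a hΨ hΨ₁ _ V G rfl hG
  obtain ⟨v, -, hv⟩ : ∃ v ∈ (Finset.univ : Finset U), Fintype.card U * K.degree v ≤
      2 * #K.edgeFinset := by
    refine Finset.exists_le_of_sum_le Finset.univ_nonempty ?_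
    rw [← Finset.mul_sum, sum_degrees_eq_twice_card_edges, Finset.sum_const, Finset.card_univ,
      smul_eq_mul]
  obtain ⟨H, hHK, hH⟩ : ∃ H : SimpleGraph {w // K.Adj v w}, H.IsMinorOf K ∧
      ∀ a b, H.Adj a b ↔ K.Adj a b :=
    ⟨_, K.isMinorOf_induce {w | K.Adj v w}, fun _ _ => Iff.rfl⟩
  refine ⟨Fintype.card U, #K.edgeFinset, {w // K.Adj v w}, inferInstance, ?_, H,
    hHK.trans hKG, Fintype.card_pos, hlow, hup, ?_, ?_, ?_⟩
  · obtain ⟨x, hx⟩ := hiso v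
    exact ⟨⟨x, hx⟩⟩
  · have := K.card_edgeFinset_le_card_choose_two
    rw [Nat.choose_two_right] at this
    omega
  · rwa [Fintype.card_subtype, ← neighborFinset_eq_filter, card_neighborFinset_eq_degree]
  · intro w
    refine (htri v w.1 w.2).trans_le ?_
    gcongr
    rw [← card_neighborFinset_eq_degree, neighborFinset_eq_filter]
    refine Finset.card_le_card_of_surjOn Subtype.val ?_
    intro u hu
    simp only [commonNbrs, Finset.coe_filter, Finset.mem_univ, true_and,
      Set.mem_ofPred_eq] at hu
    exact ⟨⟨u, hu.1⟩, by simpa [hH] using hu.2, rfl⟩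

/-- A graph of large minimum degree has a dense minor of comparable size. -/
theorem exists_dense_minor [Fintype V] [Nonempty V] (G : SimpleGraph V) {d : ℕ} (hd : 100 ≤ d)
    (hG : ∀ v, 2 * d ≤ G.degree v) :
    ∃ (W : Type u) (_ : Fintype W) (_ : Nonempty W) (H : SimpleGraph W), H.IsMinorOf G ∧
      d ≤ 3 * Fintype.card W ∧ ∀ w, 3 * Fintype.card W ≤ 5 * H.degree w := by
  have h0 : d * Fintype.card V ≤ 1 * #G.edgeFinset := by
    have h := Finset.card_nsmul_le_sum Finset.univ (fun v => G.degree v) (2 * d) fun v _ => hG v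
    rw [sum_degrees_eq_twice_card_edges, Finset.card_univ, smul_eq_mul] at h
    nlinarith
  obtain ⟨n, e, W, _, _, H, hHG, hn, h1, h2, -, h4, h5⟩ :=
    G.exists_minor_neighborhood 1 (Ψ := fun m => d * m)
      (fun _ _ h => Nat.mul_le_mul_left d h) (by omega) h0
  have he : e = d * n := by omega
  have hcard : Fintype.card W ≤ 2 * d := by
    rw [he] at h4
    refine Nat.le_of_mul_le_mul_left (h4.trans_eq ?_) hn
    ring
  have hdeg : ∀ w, d ≤ H.degree w := by
    intro w
    have := h5 w
    obtain ⟨m, rfl⟩ : ∃ m, n = m + 1 := ⟨n - 1, by omega⟩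
    simp only [Nat.add_sub_cancel, he, Nat.mul_add] at this
    omega
  have h0' : Fintype.card W ^ 2 + 2 * d * Fintype.card W ≤ 8 * #H.edgeFinset := by
    have h := Finset.card_nsmul_le_sum Finset.univ (fun v => H.degree v) d fun v _ => hdeg v
    rw [sum_degrees_eq_twice_card_edges, Finset.card_univ, smul_eq_mul] at h
    nlinarith
  obtain ⟨m, f, U, _, _, K, hKH, hm, k1, k2, k3, k4, k5⟩ :=
    H.exists_minor_neighborhood 8 (Ψ := fun m => m ^ 2 + 2 * d * m)
      (fun x y h => show x ^ 2 + 2 * d * x ≤ y ^ 2 + 2 * d * y by gcongr) (by omega) h0'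
  obtain ⟨m, rfl⟩ : ∃ l, m = l + 1 := ⟨m - 1, by omega⟩
  simp only [Nat.add_sub_cancel] at k1 k2 k3 k4 k5
  have b1 : 2 * d + 4 ≤ 3 * (m + 1) := by
    have : (m + 1) * (2 * d + 4) ≤ (m + 1) * (3 * (m + 1)) := by nlinarith
    exact Nat.le_of_mul_le_mul_left this (by omega)
  have b2 : 4 * Fintype.card U ≤ (m + 1) + 2 * d + 1 := by
    have : (m + 1) * (4 * Fintype.card U) ≤ (m + 1) * ((m + 1) + 2 * d + 1) := by nlinarith
    exact Nat.le_of_mul_le_mul_left this (by omega)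
  have b3 : ∀ w, 2 * (m + 1) + 2 * d < 9 + 8 * K.degree w := by
    intro w
    have := k5 w
    nlinarith
  refine ⟨U, inferInstance, inferInstance, K, hKH.trans hHG, ?_, fun w => ?_⟩
  · obtain ⟨w⟩ := ‹Nonempty U›
    have := b3 w
    have := K.degree_lt_card_verts w
    omega
  · have := b3 w
    omega

/-- A graph that is not `k`-colorable contains a subgraph of minimum degree at least `k`. -/
theorem exists_minor_le_degree_of_not_colorable [Fintype V] (G : SimpleGraph V) {k : ℕ}
    (hG : ¬ G.Colorable k) :
    ∃ (W : Type u) (_ : Fintype W) (_ : Nonempty W) (H : SimpleGraph W), H.IsMinorOf G ∧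
      ∀ w, k ≤ H.degree w := by
  obtain ⟨T, hT, hTk⟩ : ∃ T : Finset V, T.Nonempty ∧ ∀ v ∈ T, k ≤ #{u ∈ T | G.Adj v u} := by
    by_contra! hlow
    suffices h : ∀ S : Finset V, ∃ c : V → ℕ, (∀ v ∈ S, c v < k) ∧
        ∀ u ∈ S, ∀ v ∈ S, G.Adj u v → c u ≠ c v by
      obtain ⟨c, hc, hc'⟩ := h Finset.univ
      refine hG ⟨Coloring.mk (fun v => (⟨c v, hc v (Finset.mem_univ v)⟩ : Fin k)) ?_⟩
      intro u v huv h
      exact hc' u (Finset.mem_univ u) v (Finset.mem_univ v) huv (Fin.mk.inj_iff.1 h)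
    intro S
    induction S using Finset.strongInduction with
    | H S ih =>
      rcases S.eq_empty_or_nonempty with rfl | hS
      · exact ⟨fun _ => 0, by simp, by simp⟩
      obtain ⟨v, hv, hvk⟩ := hlow S hS
      obtain ⟨c, hc, hc'⟩ := ih (S.erase v) (Finset.erase_ssubset hv)
      obtain ⟨m, hm, hmc⟩ : ∃ m ∈ Finset.range k, m ∉ Finset.image c {u ∈ S | G.Adj v u} := by
        refine Finset.exists_mem_notMem_of_card_lt_card ?_
        rw [Finset.card_range]
        exact Finset.card_image_le.trans_lt hvk
      simp only [Finset.mem_image, Finset.mem_filter, not_exists, not_and] at hmc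
      rw [Finset.mem_range] at hm
      have hsymm : ∀ a b, G.Adj a b → G.Adj b a := fun _ _ h => h.symm
      have hirr : ∀ a, ¬ G.Adj a a := fun a => G.irrefl
      refine ⟨Function.update c v m, fun u hu => ?_, fun u hu w hw huw => ?_⟩
      · by_cases h : u = v
        · rwa [h, Function.update_self]
        · rw [Function.update_of_ne h]
          exact hc u (Finset.mem_erase.2 ⟨h, hu⟩)
      · simp only [Finset.mem_erase] at hc'
        simp only [Function.update_apply]
        grind
  obtain ⟨H, hHG, hH⟩ : ∃ H : SimpleGraph {v // v ∈ T}, H.IsMinorOf G ∧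
      ∀ a b, H.Adj a b ↔ G.Adj a b :=
    ⟨_, G.isMinorOf_induce {v | v ∈ T}, fun _ _ => Iff.rfl⟩
  refine ⟨{v // v ∈ T}, inferInstance, hT.to_subtype, H, hHG, fun w => (hTk w w.2).trans ?_⟩
  rw [← card_neighborFinset_eq_degree, neighborFinset_eq_filter]
  refine Finset.card_le_card_of_surjOn Subtype.val ?_
  intro u hu
  simp only [Finset.coe_filter, Set.mem_ofPred_eq] at hu
  exact ⟨⟨u, hu.1⟩, by simpa [hH] using hu.2, rfl⟩

/-- The vertices with no neighbour in `S`. -/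
noncomputable def undominated [Fintype V] (G : SimpleGraph V) (S : Finset V) : Finset V :=
  {v | ∀ u ∈ S, ¬ G.Adj v u}

theorem undominated_anti [Fintype V] (G : SimpleGraph V) {S T : Finset V} (h : S ⊆ T) :
    G.undominated T ⊆ G.undominated S := by
  intro v hv
  simp only [undominated, Finset.mem_filter, Finset.mem_univ, true_and] at hv ⊢
  exact fun u hu => hv u (h hu)

/-- The number of `k`-tuples of elements of `M` with all entries in `S`. -/
theorem card_tuples_in {M : Finset V} (k : ℕ) (S : Finset V) :
    #{a : Fin k → M | ∀ i, (a i : V) ∈ S} = #(M ∩ S) ^ k := by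
  have h : ({a : Fin k → M | ∀ i, (a i : V) ∈ S} : Finset _) =
      Fintype.piFinset fun _ : Fin k => ({m : M | (m : V) ∈ S} : Finset M) := by
    ext a; simp
  rw [h, Fintype.card_piFinset_const]
  congr 1
  refine Finset.card_bij (fun m _ => m.1) ?_ ?_ ?_
  · intro m hm
    simp only [Finset.mem_filter, Finset.mem_univ, true_and] at hm
    exact Finset.mem_inter.2 ⟨m.2, hm⟩
  · intro a _ b _ h
    exact Subtype.ext h
  · intro v hv
    rw [Finset.mem_inter] at hv
    exact ⟨⟨v, hv.1⟩, by simpa using hv.2, rfl⟩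

/-- If every vertex sees at least half of `M`, then some `k`-tuple in `M` dominates almost all
vertices and escapes each set of a short list of small sets. -/
theorem exists_dominating_tuple [Fintype V] [Nonempty V] (G : SimpleGraph V) {M : Finset V}
    {k t : ℕ} (ht : 2 * t * 4 ^ k ≤ 2 ^ (k * k)) (hM : Fintype.card V ≤ 2 * #M)
    (hdeg : ∀ v, #M ≤ 2 * #{u ∈ M | G.Adj v u}) {ι : Type*} (J : Finset ι) (hJ : #J < t)
    (U : ι → Finset V) (hU : ∀ j ∈ J, 2 ^ k * #(U j) < 2 * Fintype.card V) :
    ∃ A : Finset V, A ⊆ M ∧ #A ≤ k ∧ 2 ^ k * #(G.undominated A) < 2 * Fintype.card V ∧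
      ∀ j ∈ J, ∃ a ∈ A, a ∉ U j := by
  set N := Fintype.card V with hN
  have hNpos : 0 < N := Fintype.card_pos
  set Ω : Finset (Fin k → M) := Finset.univ with hΩ
  have hΩc : #Ω = #M ^ k := by simp [hΩ]
  let img : (Fin k → M) → Finset V := fun a => Finset.univ.image fun i => (a i : V)
  let bad : Finset (Fin k → M) := {a | 2 * N ≤ 2 ^ k * #(G.undominated (img a))}
  let miss : ι → Finset (Fin k → M) := fun j => {a | ∀ i, (a i : V) ∈ U j}
  have hbad : 2 * #bad ≤ #M ^ k := by
    have h1 : ∑ a : Fin k → M, 2 ^ k * #(G.undominated (img a)) ≤ N * #M ^ k := by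
      rw [← Finset.mul_sum]
      have h2 : ∑ a : Fin k → M, #(G.undominated (img a)) =
          ∑ v : V, #(M ∩ ({u | ¬ G.Adj v u} : Finset V)) ^ k := by
        simp_rw [← card_tuples_in, undominated, Finset.card_filter]
        rw [Finset.sum_comm]
        refine Finset.sum_congr rfl fun v _ => Finset.sum_congr rfl fun a _ => ?_
        simp [img]
      rw [h2, Finset.mul_sum, ← smul_eq_mul, hN, ← Finset.card_univ]
      refine Finset.sum_le_card_nsmul _ _ _ fun v _ => ?_
      rw [← mul_pow]
      refine Nat.pow_le_pow_left ?_ k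
      have h3 := Finset.card_filter_add_card_filter_not (s := M) (fun u => G.Adj v u)
      have h4 : M ∩ ({u | ¬ G.Adj v u} : Finset V) = {u ∈ M | ¬ G.Adj v u} := by
        ext u; simp
      have := hdeg v
      rw [h4]
      omega
    have h5 : #bad * (2 * N) ≤ N * #M ^ k := by
      refine le_trans ?_ h1
      rw [← smul_eq_mul]
      refine (Finset.card_nsmul_le_sum bad _ (2 * N) fun a ha => ?_).trans
        (Finset.sum_le_sum_of_subset (Finset.subset_univ bad))
      simpa [bad] using ha
    refine Nat.le_of_mul_le_mul_left ?_ hNpos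
    linarith
  have hmiss : ∀ j ∈ J, 2 ^ (k * k) * #(miss j) ≤ 4 ^ k * #M ^ k := by
    intro j hj
    have h1 : #(miss j) ≤ #(U j) ^ k := by
      rw [show #(miss j) = _ from card_tuples_in k (U j)]
      exact Nat.pow_le_pow_left (Finset.card_le_card Finset.inter_subset_right) k
    calc 2 ^ (k * k) * #(miss j) ≤ 2 ^ (k * k) * #(U j) ^ k := Nat.mul_le_mul_left _ h1
      _ = (2 ^ k * #(U j)) ^ k := by rw [mul_pow, ← pow_mul]
      _ ≤ (4 * #M) ^ k := Nat.pow_le_pow_left (by have := hU j hj; omega) k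
      _ = 4 ^ k * #M ^ k := mul_pow _ _ _
  have hMpos : 0 < #M ^ k := pow_pos (by omega) k
  have hcover : #(bad ∪ J.biUnion miss) < #Ω := by
    rw [hΩc]
    have h1 : #(bad ∪ J.biUnion miss) ≤ #bad + ∑ j ∈ J, #(miss j) :=
      (Finset.card_union_le _ _).trans (Nat.add_le_add_left Finset.card_biUnion_le _)
    have h2 : 2 ^ (k * k) * ∑ j ∈ J, #(miss j) ≤ #J * (4 ^ k * #M ^ k) := by
      rw [Finset.mul_sum, ← smul_eq_mul (a := #J)]
      exact Finset.sum_le_card_nsmul _ _ _ hmiss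
    have h3 : 2 * ∑ j ∈ J, #(miss j) < #M ^ k := by
      have h4 : 0 < 4 ^ k * #M ^ k := by positivity
      have h5 : #J * (4 ^ k * #M ^ k) < t * (4 ^ k * #M ^ k) :=
        Nat.mul_lt_mul_of_pos_right hJ h4
      have h6 := Nat.mul_le_mul_right (#M ^ k) ht
      have h7 : 2 ^ (k * k) * (2 * ∑ j ∈ J, #(miss j)) < 2 ^ (k * k) * #M ^ k := by
        linarith
      exact lt_of_mul_lt_mul_left h7 (Nat.zero_le _)
    omega
  obtain ⟨a, -, ha⟩ := Finset.exists_mem_notMem_of_card_lt_card hcover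
  simp only [Finset.mem_union, Finset.mem_biUnion, not_or, not_exists, not_and] at ha
  refine ⟨img a, ?_, ?_, ?_, fun j hj => ?_⟩
  · intro v hv
    obtain ⟨i, -, rfl⟩ := Finset.mem_image.1 hv
    exact (a i).2
  · exact Finset.card_image_le.trans (by simp)
  · simpa [bad] using ha.1
  · have := ha.2 j hj
    simp only [miss, Finset.mem_filter, Finset.mem_univ, true_and, not_forall] at this
    obtain ⟨i, hi⟩ := this
    exact ⟨a i, Finset.mem_image_of_mem _ (Finset.mem_univ i), hi⟩

theorem exists_connected_extension [Fintype V] (G : SimpleGraph V) {A : Finset V}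
    (hA : A.Nonempty) {P : V → Prop} (hP : ∀ v ∈ A, P v)
    (hcommon : ∀ x y, ∃ z, P z ∧ G.Adj x z ∧ G.Adj y z) :
    ∃ B : Finset V, A ⊆ B ∧ #B ≤ 2 * #A ∧ (∀ v ∈ B, P v) ∧
      (G.induce (B : Set V)).Connected := by
  obtain ⟨x, hx⟩ := hA
  choose c hcP hcx hcy using hcommon x
  have hmem : ∀ {v}, v ∈ A ∪ A.image c ↔ v ∈ A ∨ ∃ a ∈ A, c a = v := by simp
  refine ⟨A ∪ A.image c, Finset.subset_union_left, ?_, fun v hv => ?_, ?_⟩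
  · have h1 := Finset.card_union_le A (A.image c)
    have h2 : #(A.image c) ≤ #A := Finset.card_image_le
    omega
  · rcases hmem.1 hv with h | ⟨a, -, rfl⟩
    · exact hP v h
    · exact hcP a
  · rw [connected_iff_exists_forall_reachable]
    refine ⟨⟨x, Finset.mem_coe.2 (hmem.2 (Or.inl hx))⟩, ?_⟩
    have hc : ∀ (a : V) (ha : a ∈ A), (G.induce ((A ∪ A.image c : Finset V) : Set V)).Reachable
        ⟨x, Finset.mem_coe.2 (hmem.2 (Or.inl hx))⟩
        ⟨c a, Finset.mem_coe.2 (hmem.2 (Or.inr ⟨a, ha, rfl⟩))⟩ :=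
      fun a ha => Adj.reachable (show G.Adj x (c a) from hcx a)
    rintro ⟨v, hv⟩
    rcases hmem.1 (Finset.mem_coe.1 hv) with h | ⟨a, ha, rfl⟩
    · exact (hc v h).trans (Adj.reachable (show G.Adj (c v) v from (hcy v).symm))
    · exact hc a ha

/-- A graph of minimum degree at least three fifths of its order contains a large clique minor. -/
theorem top_isMinorOf_of_dense [Fintype V] [Nonempty V] (G : SimpleGraph V) {k t : ℕ}
    (hk : 0 < k) (ht : 2 * t * 4 ^ k ≤ 2 ^ (k * k)) (hN : 20 * k * t ≤ Fintype.card V)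
    (hdeg : ∀ v, 3 * Fintype.card V ≤ 5 * G.degree v) :
    (⊤ : SimpleGraph (Fin t)).IsMinorOf G := by
  set N := Fintype.card V with hNdef
  have hNpos : 0 < N := Fintype.card_pos
  suffices h : ∀ s ≤ t, ∃ f : ℕ → Finset V,
      (∀ i < s, (G.induce (f i : Set V)).Connected ∧ #(f i) ≤ 2 * k ∧
        2 ^ k * #(G.undominated (f i)) < 2 * N) ∧
      ∀ i < s, ∀ j < i, Disjoint (f i) (f j) ∧ ∃ u ∈ f i, ∃ v ∈ f j, G.Adj u v by
    obtain ⟨f, hf, hff⟩ := h t le_rfl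
    refine ⟨fun i => f i, fun i => (hf i i.2).1, fun i j hij => ?_, fun i j hij => ?_⟩
    · rcases lt_or_gt_of_ne hij with h | h
      · exact Finset.disjoint_coe.2 (hff j j.2 i h).1.symm
      · exact Finset.disjoint_coe.2 (hff i i.2 j h).1
    · rcases lt_or_gt_of_ne (show i ≠ j from hij) with h | h
      · obtain ⟨u, hu, v, hv, huv⟩ := (hff j j.2 i h).2
        exact ⟨v, hv, u, hu, huv.symm⟩
      · exact (hff i i.2 j h).2
  intro s
  induction s with
  | zero => exact fun _ => ⟨fun _ => ∅, by simp, by simp⟩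
  | succ s ih =>
    intro hs
    obtain ⟨f, hf, hff⟩ := ih (by omega)
    set S := (Finset.range s).biUnion f with hS
    have hScard : 10 * #S ≤ N := by
      have h1 : #S ≤ s * (2 * k) :=
        (Finset.card_biUnion_le_card_mul _ _ _ fun i hi => (hf i (Finset.mem_range.1 hi)).2.1).trans
          (by rw [Finset.card_range])
      have h2 : s * (20 * k) ≤ t * (20 * k) := Nat.mul_le_mul_right _ (by omega)
      linarith
    have hMcard : #Sᶜ = N - #S := Finset.card_compl S
    have hSN : #S ≤ N := Finset.card_le_univ S
    have hdegM : ∀ v, #Sᶜ ≤ 2 * #{u ∈ Sᶜ | G.Adj v u} := by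
      intro v
      have h1 : G.degree v ≤ #{u ∈ Sᶜ | G.Adj v u} + #S := by
        rw [← card_neighborFinset_eq_degree]
        refine (Finset.card_le_card fun u hu => ?_).trans (Finset.card_union_le _ _)
        rw [mem_neighborFinset] at hu
        simp only [Finset.mem_union, Finset.mem_filter, Finset.mem_compl]
        tauto
      have := hdeg v
      omega
    have hcommon : ∀ x y, ∃ z, z ∉ S ∧ G.Adj x z ∧ G.Adj y z := by
      intro x y
      by_contra! h
      have h1 : G.neighborFinset x ∩ G.neighborFinset y ⊆ S := by
        intro z hz
        rw [Finset.mem_inter, mem_neighborFinset, mem_neighborFinset] at hz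
        by_contra hzS
        exact h z hzS hz.1 hz.2
      have h2 := Finset.card_le_card h1
      have h3 := Finset.card_union_add_card_inter (G.neighborFinset x) (G.neighborFinset y)
      have h4 : #(G.neighborFinset x ∪ G.neighborFinset y) ≤ N := Finset.card_le_univ _
      have h5 := hdeg x
      have h6 := hdeg y
      rw [card_neighborFinset_eq_degree, card_neighborFinset_eq_degree] at h3
      omega
    obtain ⟨A, hAM, hAk, hAu, hAJ⟩ := G.exists_dominating_tuple (M := Sᶜ) ht
      (by omega) hdegM (Finset.range s) (by rw [Finset.card_range]; omega)
      (fun j => G.undominated (f j)) fun j hj => (hf j (Finset.mem_range.1 hj)).2.2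
    have hAne : A.Nonempty := by
      rw [Finset.nonempty_iff_ne_empty]
      rintro rfl
      have h1 : G.undominated ∅ = Finset.univ := by ext; simp [undominated]
      rw [h1, Finset.card_univ, ← hNdef] at hAu
      have h2 : 2 ^ 1 ≤ 2 ^ k := Nat.pow_le_pow_right two_pos hk
      have h3 := Nat.mul_le_mul_right N h2
      omega
    obtain ⟨B, hAB, hBk, hBS, hBc⟩ := G.exists_connected_extension hAne (P := fun v => v ∉ S)
      (fun v hv => Finset.mem_compl.1 (hAM hv)) hcommon
    refine ⟨Function.update f s B, fun i hi => ?_, fun i hi j hj => ?_⟩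
    · rcases Nat.lt_succ_iff_lt_or_eq.1 hi with h | rfl
      · rw [Function.update_of_ne h.ne]
        exact hf i h
      · rw [Function.update_self]
        refine ⟨hBc, by omega, lt_of_le_of_lt ?_ hAu⟩
        exact Nat.mul_le_mul_left _ (Finset.card_le_card (G.undominated_anti hAB))
    · have hjs : j < s := by omega
      rw [Function.update_of_ne hjs.ne]
      rcases Nat.lt_succ_iff_lt_or_eq.1 hi with h | rfl
      · rw [Function.update_of_ne h.ne]
        exact hff i h j hj
      · rw [Function.update_self]
        refine ⟨Finset.disjoint_left.2 fun v hv hvj => hBS v hv ?_, ?_⟩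
        · exact Finset.mem_biUnion.2 ⟨j, Finset.mem_range.2 hjs, hvj⟩
        · obtain ⟨a, ha, haj⟩ := hAJ j (Finset.mem_range.2 hjs)
          simp only [undominated, Finset.mem_filter, Finset.mem_univ, true_and, not_forall,
            not_not] at haj
          obtain ⟨v, hv, hav⟩ := haj
          exact ⟨a, hAB ha, v, hv, hav⟩

/-- The Kostochka and Thomason bound in terms of the chromatic number, with the logarithm
hidden in `k`. -/
theorem top_isMinorOf_of_not_colorable [Fintype V] (G : SimpleGraph V) {d k t : ℕ}
    (hG : ¬ G.Colorable (2 * d)) (hd : 100 ≤ d) (hk : 0 < k)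
    (ht : 2 * t * 4 ^ k ≤ 2 ^ (k * k)) (hkt : 60 * k * t ≤ d) :
    (⊤ : SimpleGraph (Fin t)).IsMinorOf G := by
  obtain ⟨W, _, _, H, hHG, hH⟩ := G.exists_minor_le_degree_of_not_colorable hG
  obtain ⟨U, _, _, K, hKH, hK, hKd⟩ := H.exists_dense_minor hd hH
  exact ((K.top_isMinorOf_of_dense hk ht (by linarith) hKd).trans hKH).trans hHG

end Density

/-- The product of two graphs of chromatic number `x ≥ y` has a `K_x` minor provided `y` exceeds
a multiple of the cube of a number `k` with `x ≤ 2 ^ (k ^ 2 - 2 * k - 1)`. -/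
theorem le_hadwigerNumber_boxProd {V₁ V₂ : Type*} [Fintype V₁] [Fintype V₂]
    {G₁ : SimpleGraph V₁} {G₂ : SimpleGraph V₂} {x y k : ℕ}
    (hx : ∀ n < x, ¬ G₁.Colorable n) (hy : ∀ n < y, ¬ G₂.Colorable n) (hyx : y ≤ x)
    (hk : 0 < k) (hkx : 2 * x * 4 ^ k ≤ 2 ^ (k * k)) (hky : 10 ^ 9 * k ^ 3 ≤ y) :
    x ≤ (G₁ □ G₂).hadwigerNumber := by
  have hk3 : k ≤ k ^ 3 := Nat.le_self_pow (by norm_num) k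
  -- `t` is the order of the clique minor of `G₁`, and `r ^ 2` that of `G₂`.
  set t := x / (250 * k) with ht
  set r := 2000 * k with hr
  have hkpos : 0 < 250 * k := by omega
  have ht1 : t * (250 * k) ≤ x := Nat.div_mul_le_self _ _
  have ht2 : x < (t + 1) * (250 * k) := by
    rw [← Nat.div_lt_iff_lt_mul hkpos]
    exact Nat.lt_succ_self t
  have hmono : ∀ s, s ≤ x → 2 * s * 4 ^ k ≤ 2 ^ (k * k) := fun s hs =>
    (Nat.mul_le_mul_right _ (Nat.mul_le_mul_left 2 hs)).trans hkx
  have htx : t ≤ x := Nat.div_le_self _ _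
  have hrk : r ^ 2 * (250 * k) = 10 ^ 9 * k ^ 3 := by rw [hr]; ring
  have h1 : (⊤ : SimpleGraph (Fin t)).IsMinorOf G₁ := by
    refine G₁.top_isMinorOf_of_not_colorable (d := (x - 1) / 2) (hx _ (by omega)) (by omega) hk
      (hmono t htx) ?_
    have h : 60 * k * t * 4 ≤ x := by nlinarith
    omega
  have h2 : (⊤ : SimpleGraph (Fin (r ^ 2))).IsMinorOf G₂ := by
    refine G₂.top_isMinorOf_of_not_colorable (d := (y - 1) / 2) (hy _ (by omega)) (by omega) hk
      (hmono _ ?_) ?_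
    · nlinarith
    · have h : 60 * k * r ^ 2 * 4 ≤ y := by nlinarith
      omega
  have e1 : Nonempty (Fin (t / 2) × Bool ↪ Fin t) := by
    rw [Function.Embedding.nonempty_iff_card_le]
    simp only [Fintype.card_prod, Fintype.card_fin, Fintype.card_bool]
    omega
  have e2 : Nonempty (Fin r × Fin r ↪ Fin (r ^ 2)) := by
    rw [Function.Embedding.nonempty_iff_card_le]
    simp [sq]
  have hminor := (top_isMinorOf_boxProd_top (Fin (t / 2)) (Fin r)).trans
    (((top_isMinorOf_top_of_embedding e1.some).trans h1).boxProd
      ((top_isMinorOf_top_of_embedding e2.some).trans h2))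
  refine le_trans ?_ (card_le_hadwigerNumber hminor)
  simp only [Fintype.card_prod, Fintype.card_fin]
  have ht3 : 8 ≤ t := by
    rw [ht, Nat.le_div_iff_mul_le hkpos]
    omega
  have h4 : t + 1 ≤ t / 2 * 8 := by omega
  calc x ≤ (t + 1) * (250 * k) := ht2.le
    _ ≤ t / 2 * 8 * (250 * k) := Nat.mul_le_mul_right _ h4
    _ = t / 2 * r := by rw [hr]; ring

end SimpleGraph

/-- A number `k` of order `√(log x)` with `x ≤ 2 ^ (k ^ 2 - 2 * k - 1)`. -/
theorem exists_nat_cube_le_log {x : ℕ} (hx : 2 ≤ x) :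
    ∃ k : ℕ, 0 < k ∧ 2 * x * 4 ^ k ≤ 2 ^ (k * k) ∧
      (k : ℝ) ^ 3 ≤ 1000 * Real.log x ^ (1.5 : ℝ) := by
  have hx' : (2 : ℝ) ≤ x := by exact_mod_cast hx
  have hlog2 : 0.69 ≤ Real.log 2 := by have := Real.log_two_gt_d9; linarith
  have hlog : Real.log 2 ≤ Real.log x := Real.log_le_log two_pos hx'
  set L := Real.log x with hL
  set s := √L with hs
  have hsq : s ^ 2 = L := Real.sq_sqrt (by linarith)
  have hs0 : 0.8 ≤ s := Real.le_sqrt_of_sq_le (by norm_num; linarith)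
  set m := ⌈2 * s⌉₊ with hm
  have hm1 : 2 * s ≤ m := Nat.le_ceil _
  have hm2 : (m : ℝ) < 2 * s + 1 := Nat.ceil_lt_add_one (by linarith)
  refine ⟨m + 3, by omega, ?_, ?_⟩
  · have hxm : x ≤ 2 ^ (m * m) := by
      have h1 : L ≤ Real.log 2 * (m * m : ℕ) := by
        push_cast
        nlinarith
      have h2 : (x : ℝ) ≤ (2 : ℝ) ^ (m * m) := by
        rw [← Real.log_le_log_iff (by linarith) (by positivity), Real.log_pow]
        linarith
      exact_mod_cast h2
    calc 2 * x * 4 ^ (m + 3) ≤ 2 * 2 ^ (m * m) * 4 ^ (m + 3) := by gcongr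
      _ = 2 ^ (1 + m * m + 2 * (m + 3)) := by
        rw [pow_add 2, pow_add 2 1, pow_mul 2 2]; norm_num
      _ ≤ 2 ^ ((m + 3) * (m + 3)) := Nat.pow_le_pow_right two_pos (by nlinarith)
  · have h3 : L ^ (1.5 : ℝ) = s ^ 3 := by
      rw [hs, Real.sqrt_eq_rpow, ← Real.rpow_natCast, ← Real.rpow_mul (by linarith)]
      norm_num
    rw [h3]
    have h4 : ((m + 3 : ℕ) : ℝ) ≤ 10 * s := by push_cast; linarith
    calc ((m + 3 : ℕ) : ℝ) ^ 3 ≤ (10 * s) ^ 3 := by gcongr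
      _ = 1000 * s ^ 3 := by ring

theorem stmt_6 :
    ∃ c' : ℝ, 0 < c' ∧
      ∀ (V₁ V₂ : Type) [Fintype V₁] [Fintype V₂]
        (G₁ : SimpleGraph V₁) (G₂ : SimpleGraph V₂),
        G₂.chromaticNumber ≤ G₁.chromaticNumber →
        c' * Real.log (G₁.chromaticNumber.toNat : ℝ) ^ (1.5 : ℝ) ≤
          (G₂.chromaticNumber.toNat : ℝ) →
        (G₁ □ G₂).chromaticNumber ≤ ((G₁ □ G₂).hadwigerNumber : ℕ∞) := by
  refine ⟨10 ^ 12, by norm_num, fun V₁ V₂ _ _ G₁ G₂ hle hlog => ?_⟩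
  have hfin : ∀ {V : Type} [Fintype V] (G : SimpleGraph V),
      ∃ n : ℕ, G.chromaticNumber = n ∧ G.Colorable n ∧ ∀ m < n, ¬ G.Colorable m := by
    intro V _ G
    obtain ⟨n, hn⟩ := ENat.ne_top_iff_exists.1
      (chromaticNumber_ne_top_iff_exists.2 ⟨_, G.colorable_of_fintype⟩)
    refine ⟨n, hn.symm, chromaticNumber_le_iff_colorable.1 hn.ge, fun m hm hc => ?_⟩
    have := hc.chromaticNumber_le
    rw [← hn] at this
    exact absurd (Nat.cast_le.1 this) (by omega)
  obtain ⟨x, hx, hxc, hxm⟩ := hfin G₁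
  obtain ⟨y, hy, hyc, hym⟩ := hfin G₂
  rw [hx, hy, Nat.cast_le] at hle
  rw [hx, hy, ENat.toNat_natCast, ENat.toNat_natCast] at hlog
  have hcol : (G₁ □ G₂).Colorable x := hxc.boxProd (hyc.mono hle)
  rcases isEmpty_or_nonempty (V₁ × V₂) with hV | ⟨⟨v⟩⟩
  · rw [chromaticNumber_eq_zero_of_isEmpty]
    exact zero_le
  refine hcol.chromaticNumber_le.trans (Nat.cast_le.2 ?_)
  rcases lt_or_ge x 2 with hx2 | hx2
  · have h : (⊤ : SimpleGraph Unit).IsMinorOf (G₁ □ G₂) :=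
      .of_injective_hom ⟨fun _ => v, fun h => absurd rfl h⟩ (Function.injective_of_subsingleton _)
    have := card_le_hadwigerNumber h
    rw [Fintype.card_unit] at this
    omega
  · obtain ⟨k, hk, hkx, hkL⟩ := exists_nat_cube_le_log hx2
    refine le_hadwigerNumber_boxProd hxm hym hle hk hkx ?_
    have : (10 : ℝ) ^ 9 * (k : ℝ) ^ 3 ≤ y := by linarith
    exact_mod_cast this
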